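/- The map t ↦ M(t) is injective on Y_n, and every point M(t), for t ∈ Y_n, is an extreme point of the convex hull of {M(s) : s ∈ Y_n}; hence the vertices of this polytope are in bijection with the planar binary trees with n+1 leaves. -/

import Mathlib

/-- Planar binary trees: a tree is either a single leaf, or the grafting
`node l r = l ∨ r` of two planar binary trees. `Y n` is the set of such trees with
`n + 1` leaves. -/
inductive PBT : Type
  | leaf : PBT
  | node : PBT → PBT → PBT
  deriving DecidableEq

namespace PBT

/-- Number of leaves of a planar binary tree. A tree of `Y n` has `n + 1` leaves. -/
def leaves : PBT → ℕ
  | leaf => 1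
  | node l r => l.leaves + r.leaves

/-- The list of coordinates of Loday's point `M(t)`: `M(|)` is the empty tuple and
`M(t^l ∨ t^r) = (M(t^l), p·q, M(t^r))` where `p`, `q` are the numbers of leaves of
`t^l`, `t^r`.  The `i`-th entry is the weight `a_i · b_i` of the `i`-th internal
vertex of `t`.  A tree `t` belongs to `Y n` iff `t.coords.length = n`. -/
noncomputable def coords : PBT → List ℝ
  | leaf => []
  | node l r => l.coords ++ ((l.leaves : ℝ) * (r.leaves : ℝ)) :: r.coords

/-- The point `M(t) = (a_1 b_1, …, a_n b_n) ∈ ℝ^n`, for `t ∈ Y n`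
(coordinates indexed by `Fin n`, the `i`-th coordinate being `x_{i+1}`). -/
noncomputable def M (n : ℕ) (t : PBT) : Fin n → ℝ := fun i => t.coords.getD i 0

end PBT

namespace PBT

/-- The coordinate list of `t`, extended by zero to a function on `ℕ`. -/
noncomputable def coord (t : PBT) (i : ℕ) : ℝ := t.coords.getD i 0

theorem leaves_eq_length_add_one (t : PBT) : t.leaves = t.coords.length + 1 := by
  induction t with
  | leaf => rfl
  | node l r hl hr => simp [leaves, coords, hl, hr]; omega

theorem length_coords_node (l r : PBT) :
    (node l r).coords.length = l.coords.length + 1 + r.coords.length := by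
  simp [coords]; omega

theorem coord_node_left (l r : PBT) {i : ℕ} (h : i < l.coords.length) :
    (node l r).coord i = l.coord i := by
  simp [coord, coords, List.getElem?_append_left h]

theorem coord_node_root (l r : PBT) :
    (node l r).coord l.coords.length
      = ((l.coords.length : ℝ) + 1) * ((r.coords.length : ℝ) + 1) := by
  simp [coord, coords, leaves_eq_length_add_one]

theorem coord_node_right (l r : PBT) (i : ℕ) :
    (node l r).coord (l.coords.length + 1 + i) = r.coord i := by
  have h : l.coords.length + 1 + i - l.coords.length = i + 1 := by omega
  simp only [coord, coords, List.getD_eq_getElem?_getD]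
  rw [List.getElem?_append_right (by omega), h, List.getElem?_cons_succ]

/-- A consecutive sum of length `j + 1 + k`, split at its `j`-th term. -/
theorem sum_range_split (f : ℕ → ℝ) (j k : ℕ) :
    ∑ i ∈ Finset.range (j + 1 + k), f i
      = ∑ i ∈ Finset.range j, f i + f j + ∑ i ∈ Finset.range k, f (j + 1 + i) := by
  rw [Finset.sum_range_add, Finset.sum_range_succ]

theorem sum_coord (t : PBT) :
    ∑ i ∈ Finset.range t.coords.length, t.coord i
      = (t.coords.length : ℝ) * (t.coords.length + 1) / 2 := by
  induction t with
  | leaf => simp [coords]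
  | node l r hl hr =>
    rw [length_coords_node, sum_range_split, coord_node_root,
      Finset.sum_congr rfl fun i hi => coord_node_left l r (Finset.mem_range.1 hi),
      Finset.sum_congr rfl fun i _ => coord_node_right l r i, hl, hr]
    push_cast
    ring

/-- The first `n` terms of `x` satisfy the inequalities defining the associahedron: every sum of
`k` consecutive terms is at least `1 + ⋯ + k`. -/
def WindowBound (n : ℕ) (x : ℕ → ℝ) : Prop :=
  ∀ a k : ℕ, a + k ≤ n → (k : ℝ) * (k + 1) / 2 ≤ ∑ i ∈ Finset.range k, x (a + i)

theorem WindowBound.mono {m n : ℕ} {x : ℕ → ℝ} (h : WindowBound n x) (hmn : m ≤ n) :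
    WindowBound m x := fun a k hk => h a k (hk.trans hmn)

theorem WindowBound.shift {m n c : ℕ} {x : ℕ → ℝ} (h : WindowBound n x) (hmn : c + m ≤ n) :
    WindowBound m fun i => x (c + i) := fun a k hk => by
  simpa only [add_assoc] using h (c + a) k (by omega)

theorem windowBound_coord (t : PBT) : WindowBound t.coords.length t.coord := by
  induction t with
  | leaf =>
    intro a k hk
    obtain rfl : k = 0 := by simp only [coords, List.length_nil] at hk; omega
    simp
  | node l r hl hr =>
    intro a k hk
    rw [length_coords_node] at hk
    rcases le_or_gt (a + k) l.coords.length with h | h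
    · refine (hl a k h).trans_eq (Finset.sum_congr rfl fun i hi => ?_)
      rw [coord_node_left l r (by have := Finset.mem_range.1 hi; omega)]
    rcases lt_or_ge l.coords.length a with h' | h'
    · obtain ⟨c, rfl⟩ := Nat.exists_eq_add_of_le (Nat.succ_le_of_lt h')
      refine (hr c k (by omega)).trans_eq (Finset.sum_congr rfl fun i _ => ?_)
      rw [Nat.succ_eq_add_one, add_assoc (l.coords.length + 1), coord_node_right]
    obtain ⟨j, hj⟩ := Nat.exists_eq_add_of_le h'
    obtain ⟨m, rfl⟩ := Nat.exists_eq_add_of_le (show j + 1 ≤ k by omega)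
    have e₁ : ∑ i ∈ Finset.range j, (node l r).coord (a + i)
        = ∑ i ∈ Finset.range j, l.coord (a + i) :=
      Finset.sum_congr rfl fun i hi =>
        coord_node_left l r (by have := Finset.mem_range.1 hi; omega)
    have e₂ : ∑ i ∈ Finset.range m, (node l r).coord (a + (j + 1 + i))
        = ∑ i ∈ Finset.range m, r.coord (0 + i) :=
      Finset.sum_congr rfl fun i _ => by
        rw [show a + (j + 1 + i) = l.coords.length + 1 + i by omega, coord_node_right, zero_add]
    have b₁ := hl a j (by omega)
    have b₂ := hr 0 m (by omega)
    rw [sum_range_split fun i => (node l r).coord (a + i), e₁, e₂, ← hj, coord_node_root]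
    have hjl : (j : ℝ) ≤ l.coords.length := by exact_mod_cast (by omega : j ≤ l.coords.length)
    have hmr : (m : ℝ) ≤ r.coords.length := by exact_mod_cast (by omega : m ≤ r.coords.length)
    have hprod : ((j : ℝ) + 1) * (m + 1)
        ≤ ((l.coords.length : ℝ) + 1) * ((r.coords.length : ℝ) + 1) := by gcongr
    push_cast
    nlinarith

/-- If the coordinates of `t` are a proper convex combination of two sequences satisfying the
window inequalities, then both sequences agree with the coordinates of `t`. Stated for the first
of the two sequences. -/
theorem eq_coord_of_combination (t : PBT) {α β : ℝ} (hα : 0 < α) (hβ : 0 < β) (hαβ : α + β = 1)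
    {y z : ℕ → ℝ} (hy : WindowBound t.coords.length y) (hz : WindowBound t.coords.length z)
    (h : ∀ i < t.coords.length, α * y i + β * z i = t.coord i) :
    ∀ i < t.coords.length, y i = t.coord i := by
  induction t generalizing y z with
  | leaf => simp [coords]
  | node l r hl hr =>
    have hsum : ∑ i ∈ Finset.range (node l r).coords.length, y i
        = ((node l r).coords.length : ℝ) * ((node l r).coords.length + 1) / 2 := by
      have hy' := hy 0 _ (zero_add _).le
      have hz' := hz 0 _ (zero_add _).le
      simp only [zero_add] at hy' hz'
      have hs := sum_coord (node l r)
      rw [← Finset.sum_congr rfl fun i hi => h i (Finset.mem_range.1 hi),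
        Finset.sum_add_distrib, ← Finset.mul_sum, ← Finset.mul_sum] at hs
      obtain rfl : β = 1 - α := by linarith
      nlinarith
    have hlen := length_coords_node l r
    have hleft : ∀ i < l.coords.length, y i = l.coord i :=
      hl (hy.mono (by omega)) (hz.mono (by omega)) fun i hi => by
        rw [h i (by omega), coord_node_left l r hi]
    have hright : ∀ i < r.coords.length, y (l.coords.length + 1 + i) = r.coord i :=
      hr (hy.shift (c := l.coords.length + 1) (by omega))
        (hz.shift (c := l.coords.length + 1) (by omega)) fun i hi => by
        rw [h (l.coords.length + 1 + i) (by omega), coord_node_right]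
    have hroot : y l.coords.length = (node l r).coord l.coords.length := by
      rw [hlen, sum_range_split, Finset.sum_congr rfl fun i hi => hleft i (Finset.mem_range.1 hi),
        Finset.sum_congr rfl fun i hi => hright i (Finset.mem_range.1 hi), sum_coord,
        sum_coord] at hsum
      rw [coord_node_root]
      push_cast at hsum
      linarith
    intro i hi
    rcases lt_trichotomy i l.coords.length with h' | rfl | h'
    · rw [hleft i h', coord_node_left l r h']
    · exact hroot
    · obtain ⟨c, rfl⟩ := Nat.exists_eq_add_of_le (Nat.succ_le_of_lt h')
      rw [Nat.succ_eq_add_one, coord_node_right]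
      exact hright c (by omega)

theorem length_left_le_of_coords_eq {l r l' r' : PBT}
    (h : (node l r).coords = (node l' r').coords) : l'.coords.length ≤ l.coords.length := by
  by_contra! hlt
  obtain ⟨k, hk⟩ := Nat.exists_eq_add_of_le (Nat.succ_le_of_lt hlt)
  rw [Nat.succ_eq_add_one] at hk
  have hcoord : (node l r).coord = (node l' r').coord := by
    funext i
    rw [coord, coord, h]
  have hlen : l.coords.length + 1 + r.coords.length
      = l'.coords.length + 1 + r'.coords.length := by
    rw [← length_coords_node, ← length_coords_node, h]
  have hs := sum_coord l'
  rw [← Finset.sum_congr rfl fun i hi => coord_node_left l' r' (Finset.mem_range.1 hi),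
    ← hcoord, hk, sum_range_split, coord_node_root,
    Finset.sum_congr rfl fun i hi => coord_node_left l r (Finset.mem_range.1 hi),
    Finset.sum_congr rfl fun i _ => coord_node_right l r i, sum_coord] at hs
  have hr := windowBound_coord r 0 k (by omega)
  simp only [zero_add] at hr
  have hkr : (k : ℝ) + 1 ≤ r.coords.length := by
    exact_mod_cast (by omega : k + 1 ≤ r.coords.length)
  have hprod : ((l.coords.length : ℝ) + 1) * (k + 1 + 1)
      ≤ ((l.coords.length : ℝ) + 1) * ((r.coords.length : ℝ) + 1) := by gcongr
  have hpos : (0 : ℝ) ≤ l.coords.length := Nat.cast_nonneg _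
  push_cast at hs
  nlinarith

theorem coords_injective : Function.Injective coords := by
  intro t
  induction t with
  | leaf =>
    rintro (_ | ⟨l', r'⟩) h
    · rfl
    · simp [coords] at h
  | node l r hl hr =>
    rintro (_ | ⟨l', r'⟩) h
    · simp [coords] at h
    · obtain ⟨h₁, h₂⟩ := List.append_inj h
        (le_antisymm (length_left_le_of_coords_eq h.symm) (length_left_le_of_coords_eq h))
      rw [hl h₁, hr (List.cons.inj h₂).2]

/-- Extension by zero of a vector to a sequence. -/
def extendZero {n : ℕ} (x : Fin n → ℝ) (i : ℕ) : ℝ := if h : i < n then x ⟨i, h⟩ else 0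

theorem extendZero_M {n : ℕ} {t : PBT} (ht : t.coords.length = n) :
    extendZero (M n t) = t.coord := by
  funext i
  unfold extendZero
  split_ifs with h
  · rfl
  · rw [coord, List.getD_eq_default _ _ (by omega)]

theorem extendZero_combination {n : ℕ} (α β : ℝ) (x y : Fin n → ℝ) (i : ℕ) :
    extendZero (α • x + β • y) i = α * extendZero x i + β * extendZero y i := by
  unfold extendZero
  split_ifs <;> simp

theorem convex_windowBound (n : ℕ) : Convex ℝ {x : Fin n → ℝ | WindowBound n (extendZero x)} := by
  intro x hx y hy α β hα hβ hαβ a k hk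
  simp only [extendZero_combination, Finset.sum_add_distrib, ← Finset.mul_sum]
  have h₁ := mul_le_mul_of_nonneg_left (hx a k hk) hα
  have h₂ := mul_le_mul_of_nonneg_left (hy a k hk) hβ
  obtain rfl : β = 1 - α := by linarith
  linarith

theorem windowBound_of_mem_convexHull {n : ℕ} {x : Fin n → ℝ}
    (hx : x ∈ convexHull ℝ {x : Fin n → ℝ | ∃ s : PBT, s.coords.length = n ∧ x = M n s}) :
    WindowBound n (extendZero x) := by
  refine convexHull_min ?_ (convex_windowBound n) hx
  rintro _ ⟨s, hs, rfl⟩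
  rw [Set.mem_ofPred_eq, extendZero_M hs, ← hs]
  exact windowBound_coord s

end PBT

/-- The map `t ↦ M(t)` is injective on `Y n`, and every point `M(t)`, `t ∈ Y n`, is an
extreme point of the convex hull of `{M(s) : s ∈ Y n}`; hence the vertices of this
polytope are in bijection with the planar binary trees with `n+1` leaves. -/
theorem stmt4 (n : ℕ) :
    (∀ t t' : PBT, t.coords.length = n → t'.coords.length = n →
      PBT.M n t = PBT.M n t' → t = t') ∧
    (∀ t : PBT, t.coords.length = n →
      PBT.M n t ∈ Set.extremePoints ℝ
        (convexHull ℝ {x : Fin n → ℝ | ∃ s : PBT, s.coords.length = n ∧ x = PBT.M n s})) := by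
  refine ⟨fun t t' ht ht' h => PBT.coords_injective ?_, fun t ht => ?_⟩
  · refine List.ext_getElem (ht.trans ht'.symm) fun i hi hi' => ?_
    have hM := congrFun h ⟨i, ht ▸ hi⟩
    simpa only [PBT.M, List.getD_eq_getElem _ _ hi, List.getD_eq_getElem _ _ hi'] using hM
  · rw [mem_extremePoints_iff_left]
    refine ⟨subset_convexHull ℝ _ ⟨t, ht, rfl⟩, ?_⟩
    rintro y hy z hz ⟨α, β, hα, hβ, hαβ, hyz⟩
    have hy' := PBT.windowBound_of_mem_convexHull hy
    have hz' := PBT.windowBound_of_mem_convexHull hz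
    subst ht
    funext i
    have hi := PBT.eq_coord_of_combination t hα hβ hαβ hy' hz'
      (fun j _ => by rw [← PBT.extendZero_combination, hyz, PBT.extendZero_M rfl]) i i.2
    simpa [PBT.extendZero, PBT.M, PBT.coord] using hi
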